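/- arXiv:1705.02220 — 2 statements merged into one kernel-verified Lean document; each statement's English description precedes it below -/
import Mathlib

section
/- (Theorem 6.3, 'Identity Addition', two summands.) Let (A₁, B₁, C₁) be a nontransitive triple of s-sided dice and (A₂, B₂, C₂) a nontransitive triple of t-sided dice, both with the win chain A beats B, B beats C, C beats A, and suppose every face value appearing in the second triple is strictly greater than every face value appearing in the first triple. Then the concatenated triple (A₁ ⊕ A₂, B₁ ⊕ B₂, C₁ ⊕ C₂) of (s+t)-sided dice is nontransitive with the same win chain. -/
/-- Number of (face, face) pairs where die `d` shows a strictly higher value than die `e`. -/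
def wins {α β : Type*} [Fintype α] [Fintype β] (d : α → ℤ) (e : β → ℤ) : ℕ :=
  (Finset.univ.filter (fun p : α × β => e p.2 < d p.1)).card

/-- Number of (face, face) pairs where dice `d` and `e` show equal values. -/
def ties {α β : Type*} [Fintype α] [Fintype β] (d : α → ℤ) (e : β → ℤ) : ℕ :=
  (Finset.univ.filter (fun p : α × β => d p.1 = e p.2)).card

/-- Die `d` beats die `e` if `d` wins against `e` more often than `e` wins against `d`. -/
def Beats {α β : Type*} [Fintype α] [Fintype β] (d : α → ℤ) (e : β → ℤ) : Prop :=
  wins e d < wins d e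

instance {α β : Type*} [Fintype α] [Fintype β] (d : α → ℤ) (e : β → ℤ) :
    Decidable (Beats d e) := Nat.decLt _ _

/-- A triple of dice is nontransitive if A beats B, B beats C, and C beats A. -/
def Nontransitive {α : Type*} [Fintype α] (A B C : α → ℤ) : Prop :=
  Beats A B ∧ Beats B C ∧ Beats C A

theorem wins_eq_sum {α β : Type*} [Fintype α] [Fintype β] (d : α → ℤ) (e : β → ℤ) :
    wins d e = ∑ i, ∑ j, if e j < d i then 1 else 0 := by
  rw [wins, Finset.card_filter, Fintype.sum_prod_type]

theorem wins_append {s t u v : ℕ} (d₁ : Fin s → ℤ) (d₂ : Fin t → ℤ)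
    (e₁ : Fin u → ℤ) (e₂ : Fin v → ℤ) :
    wins (Fin.append d₁ d₂) (Fin.append e₁ e₂) =
      wins d₁ e₁ + wins d₁ e₂ + (wins d₂ e₁ + wins d₂ e₂) := by
  simp only [wins_eq_sum, Fin.sum_univ_add, Fin.append_left, Fin.append_right,
    Finset.sum_add_distrib]
  exact add_add_add_comm _ _ _ _

theorem wins_eq_zero {α β : Type*} [Fintype α] [Fintype β] {d : α → ℤ} {e : β → ℤ}
    (h : ∀ i j, d i ≤ e j) : wins d e = 0 := by
  simp [wins, Finset.filter_eq_empty_iff, h]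

theorem wins_eq_card_mul_card {α β : Type*} [Fintype α] [Fintype β] {d : α → ℤ} {e : β → ℤ}
    (h : ∀ i j, e j < d i) : wins d e = Fintype.card α * Fintype.card β := by
  simp [wins, h]

theorem Beats.append {s t : ℕ} {d₁ e₁ : Fin s → ℤ} {d₂ e₂ : Fin t → ℤ}
    (h₁ : Beats d₁ e₁) (h₂ : Beats d₂ e₂)
    (hde : ∀ i j, d₁ i < e₂ j) (hed : ∀ i j, e₁ i < d₂ j) :
    Beats (Fin.append d₁ d₂) (Fin.append e₁ e₂) := by
  unfold Beats at *
  rw [wins_append, wins_append, wins_eq_zero fun i j => (hde i j).le,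
    wins_eq_zero fun i j => (hed i j).le, wins_eq_card_mul_card fun i j => hde j i,
    wins_eq_card_mul_card fun i j => hed j i]
  omega

/-- Theorem 6.3, "Identity Addition", two summands. -/
theorem identity_addition_two
    {s t : ℕ} (A₁ B₁ C₁ : Fin s → ℤ) (A₂ B₂ C₂ : Fin t → ℤ)
    (h₁ : Nontransitive A₁ B₁ C₁) (h₂ : Nontransitive A₂ B₂ C₂)
    (hsep : ∀ (i : Fin s) (j : Fin t),
      (A₁ i < A₂ j ∧ A₁ i < B₂ j ∧ A₁ i < C₂ j) ∧
      (B₁ i < A₂ j ∧ B₁ i < B₂ j ∧ B₁ i < C₂ j) ∧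
      (C₁ i < A₂ j ∧ C₁ i < B₂ j ∧ C₁ i < C₂ j)) :
    Nontransitive (Fin.append A₁ A₂) (Fin.append B₁ B₂) (Fin.append C₁ C₂) := by
  obtain ⟨hAB₁, hBC₁, hCA₁⟩ := h₁
  obtain ⟨hAB₂, hBC₂, hCA₂⟩ := h₂
  exact ⟨hAB₁.append hAB₂ (fun i j => (hsep i j).1.2.1) fun i j => (hsep i j).2.1.1,
    hBC₁.append hBC₂ (fun i j => (hsep i j).2.1.2.2) fun i j => (hsep i j).2.2.2.1,
    hCA₁.append hCA₂ (fun i j => (hsep i j).2.2.1) fun i j => (hsep i j).1.2.2⟩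
end

section
/- (Theorem 6.4a, 'Identity Face Exponentiation'.) Let M > 0. Let (a, b, c) be a nontransitive triple of s-sided dice (a beats b, b beats c, c beats a) and let (p, q, r) be a nontransitive triple of m-sided dice with the same win chain orientation (p beats q, q beats r, r beats p) and with all face values of p, q, r lying in [0, M). Define the nested dice A(i, j) = M·(a i) + p j, B(i, j) = M·(b i) + q j, C(i, j) = M·(c i) + r j on Fin s × Fin m. Then (A, B, C) is a nontransitive triple of s·m-sided dice with the win chain A beats B, B beats C, C beats A. -/
theorem mul_add_lt_mul_add_iff_lex {M x y u v : ℤ} (hu : 0 ≤ u ∧ u < M) (hv : 0 ≤ v ∧ v < M) :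
    M * x + u < M * y + v ↔ x < y ∨ x = y ∧ u < v := by
  rcases lt_trichotomy x y with h | rfl | h
  · simp only [h, true_or, iff_true]
    nlinarith
  · simp
  · simp only [h.not_gt, h.ne', false_and, or_self, iff_false, not_lt]
    nlinarith

theorem ties_comm {α β : Type*} [Fintype α] [Fintype β] (d : α → ℤ) (e : β → ℤ) :
    ties d e = ties e d :=
  Finset.card_equiv (Equiv.prodComm α β) (by simp [eq_comm])

/-- Wins of nested dice are counted lexicographically. -/
theorem wins_mul_add {α β γ δ : Type*} [Fintype α] [Fintype β] [Fintype γ] [Fintype δ]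
    {M : ℤ} (d : α → ℤ) (e : β → ℤ) {p : γ → ℤ} {q : δ → ℤ}
    (hp : ∀ j, 0 ≤ p j ∧ p j < M) (hq : ∀ j, 0 ≤ q j ∧ q j < M) :
    wins (fun x : α × γ => M * d x.1 + p x.2) (fun x : β × δ => M * e x.1 + q x.2) =
      wins d e * (Fintype.card γ * Fintype.card δ) + ties d e * wins p q := by
  classical
  unfold wins ties
  rw [← Fintype.card_prod, ← Finset.card_univ, ← Finset.card_product, ← Finset.card_product,
    ← Finset.card_union_of_disjoint]
  · refine Finset.card_equiv (Equiv.prodProdProdComm α γ β δ) fun x => ?_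
    simp [mul_add_lt_mul_add_iff_lex (hq _) (hp _), eq_comm]
  · refine Finset.disjoint_left.2 fun x hx hy => ?_
    simp only [Finset.mem_product, Finset.mem_filter, Finset.mem_univ, true_and, and_true]
      at hx hy
    exact hx.ne' hy.1

theorem Beats.mul_add {α β γ δ : Type*} [Fintype α] [Fintype β] [Fintype γ] [Fintype δ]
    {M : ℤ} {d : α → ℤ} {e : β → ℤ} {p : γ → ℤ} {q : δ → ℤ}
    (hde : Beats d e) (hpq : Beats p q)
    (hp : ∀ j, 0 ≤ p j ∧ p j < M) (hq : ∀ j, 0 ≤ q j ∧ q j < M) :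
    Beats (fun x : α × γ => M * d x.1 + p x.2) (fun x : β × δ => M * e x.1 + q x.2) := by
  unfold Beats at *
  have hcard : 0 < Fintype.card γ * Fintype.card δ := by
    obtain ⟨x, -⟩ := Finset.card_pos.1 (Nat.zero_lt_of_lt hpq)
    exact Nat.mul_pos (Fintype.card_pos_iff.2 ⟨x.1⟩) (Fintype.card_pos_iff.2 ⟨x.2⟩)
  rw [wins_mul_add e d hq hp, wins_mul_add d e hp hq, ties_comm e d,
    Nat.mul_comm (Fintype.card δ)]
  exact add_lt_add_of_lt_of_le (Nat.mul_lt_mul_of_pos_right hde hcard)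
    (Nat.mul_le_mul_left _ hpq.le)

/-- Theorem 6.4a, "Identity Face Exponentiation". -/
theorem identity_face_exponentiation
    {s m : ℕ} (M : ℤ) (hM : 0 < M)
    (a b c : Fin s → ℤ) (p q r : Fin m → ℤ)
    (habc : Nontransitive a b c) (hpqr : Nontransitive p q r)
    (hp : ∀ j, 0 ≤ p j ∧ p j < M) (hq : ∀ j, 0 ≤ q j ∧ q j < M)
    (hr : ∀ j, 0 ≤ r j ∧ r j < M) :
    Nontransitive (fun x : Fin s × Fin m => M * a x.1 + p x.2)
      (fun x : Fin s × Fin m => M * b x.1 + q x.2)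
      (fun x : Fin s × Fin m => M * c x.1 + r x.2) := by
  exact ⟨habc.1.mul_add hpqr.1 hp hq, habc.2.1.mul_add hpqr.2.1 hq hr,
    habc.2.2.mul_add hpqr.2.2 hr hp⟩
end
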